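/- Let λ, β > 0 and Λ ∈ ℝ with Λ ≠ 0. Define ρ⁺ = (1 − e^{βΛ})/(e^{−λΛ} − e^{βΛ}), ρ⁻ = (1 − e^{−βΛ})/(e^{λΛ} − e^{−βΛ}), τ⁺ = (1/Λ)[ρ⁺(λ+β) − β] and τ⁻ = (1/(−Λ))[ρ⁻(λ+β) − β]. If τ⁺ = τ⁻, then β = λ. -/

import Mathlib

theorem strictMonoOn_mul_exp_add_one_div_exp_sub_one :
    StrictMonoOn (fun x : ℝ => x * (Real.exp x + 1) / (Real.exp x - 1)) (Set.Ioi 0) := by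
  have hd : ∀ x : ℝ, 0 < x → HasDerivAt
      (fun x : ℝ => x * (Real.exp x + 1) / (Real.exp x - 1))
      (((1 * (Real.exp x + 1) + x * Real.exp x) * (Real.exp x - 1) -
        x * (Real.exp x + 1) * Real.exp x) / (Real.exp x - 1) ^ 2) x := by
    intro x hx
    have hne : Real.exp x - 1 ≠ 0 := (sub_pos.2 (Real.one_lt_exp_iff.2 hx)).ne'
    exact ((hasDerivAt_id' x).mul ((Real.hasDerivAt_exp x).add_const 1)).div
      ((Real.hasDerivAt_exp x).sub_const 1) hne
  refine strictMonoOn_of_deriv_pos (convex_Ioi 0)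
    (fun x hx => (hd x hx).continuousAt.continuousWithinAt) fun x hx => ?_
  rw [interior_Ioi] at hx
  rw [(hd x hx).deriv]
  have hpos : 0 < Real.exp x - 1 := sub_pos.2 (Real.one_lt_exp_iff.2 hx)
  have hsinh : x < Real.sinh x := Real.self_lt_sinh_iff.2 hx
  have hmul : Real.exp x * Real.exp (-x) = 1 := by rw [← Real.exp_add]; simp
  rw [Real.sinh_eq] at hsinh
  refine div_pos ?_ (by positivity)
  nlinarith [mul_pos (Real.exp_pos x) (sub_pos.2 hsinh)]

theorem eq_of_mul_exp_add_one_mul_exp_sub_one_eq {x y : ℝ} (hx : 0 < x) (hy : 0 < y)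
    (h : x * (Real.exp x + 1) * (Real.exp y - 1) = y * (Real.exp y + 1) * (Real.exp x - 1)) :
    x = y := by
  have hx' : Real.exp x - 1 ≠ 0 := (sub_pos.2 (Real.one_lt_exp_iff.2 hx)).ne'
  have hy' : Real.exp y - 1 ≠ 0 := (sub_pos.2 (Real.one_lt_exp_iff.2 hy)).ne'
  exact strictMonoOn_mul_exp_add_one_div_exp_sub_one.injOn hx hy ((div_eq_div_iff hx' hy').2 h)

/-- Lemma (symmetric response times force symmetric barriers): for the DDM with
barriers `λ, β > 0` and value difference `Λ ≠ 0`, if the mean response times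
`τ⁺ = (1/Λ)[ρ⁺(λ+β) − β]` and `τ⁻ = (1/(−Λ))[ρ⁻(λ+β) − β]` coincide, then `β = λ`. -/
theorem ddm_symmetric_times_imply_symmetric_barriers
    (lam beta Lam : ℝ) (hlam : 0 < lam) (hbeta : 0 < beta) (hLam : Lam ≠ 0)
    (ρp ρm τp τm : ℝ)
    (hρp : ρp = (1 - Real.exp (beta * Lam)) /
      (Real.exp (-(lam * Lam)) - Real.exp (beta * Lam)))
    (hρm : ρm = (1 - Real.exp (-(beta * Lam))) /
      (Real.exp (lam * Lam) - Real.exp (-(beta * Lam))))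
    (hτp : τp = (1 / Lam) * (ρp * (lam + beta) - beta))
    (hτm : τm = (1 / (-Lam)) * (ρm * (lam + beta) - beta))
    (heq : τp = τm) :
    beta = lam := by
  have hsum : (ρp + ρm) * (lam + beta) = 2 * beta := by
    rw [hτp, hτm] at heq
    field_simp at heq
    linarith
  have hA := Real.exp_pos (lam * Lam)
  have hB := Real.exp_pos (beta * Lam)
  have hAB : Real.exp (lam * Lam) * Real.exp (beta * Lam) - 1 ≠ 0 := by
    rw [← Real.exp_add, ← add_mul, sub_ne_zero, Ne, Real.exp_eq_one_iff]
    exact mul_ne_zero (by positivity) hLam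
  have key : lam * (Real.exp (lam * Lam) + 1) * (Real.exp (beta * Lam) - 1) =
      beta * (Real.exp (beta * Lam) + 1) * (Real.exp (lam * Lam) - 1) := by
    rw [Real.exp_neg] at hρp hρm
    generalize Real.exp (lam * Lam) = A at *
    generalize Real.exp (beta * Lam) = B at *
    have hp : ρp = A * (B - 1) / (A * B - 1) := by
      have h : A⁻¹ - B = -(A * B - 1) / A := by field_simp; ring
      rw [hρp, h]
      field_simp
      ring
    have hm : ρm = (B - 1) / (A * B - 1) := by
      have h : A - B⁻¹ = (A * B - 1) / B := by field_simp
      rw [hρm, h]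
      field_simp
    rw [hp, hm] at hsum
    field_simp at hsum
    linarith
  rcases hLam.lt_or_gt with hneg | hpos
  · have h : beta * -Lam = lam * -Lam := by
      refine eq_of_mul_exp_add_one_mul_exp_sub_one_eq (mul_pos hbeta (neg_pos.2 hneg))
        (mul_pos hlam (neg_pos.2 hneg)) ?_
      rw [mul_neg, mul_neg, Real.exp_neg, Real.exp_neg]
      generalize Real.exp (lam * Lam) = A at *
      generalize Real.exp (beta * Lam) = B at *
      field_simp
      linear_combination -key
    exact mul_right_cancel₀ (neg_ne_zero.2 hLam) h
  · have h : beta * Lam = lam * Lam := by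
      refine eq_of_mul_exp_add_one_mul_exp_sub_one_eq (mul_pos hbeta hpos) (mul_pos hlam hpos) ?_
      linear_combination -Lam * key
    exact mul_right_cancel₀ hLam h
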